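/- arXiv:1601.04161 — 7 statements merged into one kernel-verified Lean document; each statement's English description precedes it below -/
import Mathlib

section
/- Let n, s ≥ 1, let H : ℝ^{2n} → ℝ be twice continuously differentiable, and let f = J^{-1}∇H, where J is the standard 2n×2n symplectic matrix. Let h > 0 and let real coefficients a_{ij}, α_i (1 ≤ i, j ≤ s) satisfy the symplecticity condition α_i a_{ij} + α_j a_{ji} = α_i α_j for all i, j. Fix vectors v_1, …, v_s, v ∈ ℝ^{2n}. Suppose Y_1, …, Y_s : ℝ^{2n} → ℝ^{2n} are differentiable maps satisfying Y_i(x) = x + h Σ_{j=1}^s a_{ij} f(Y_j(x)) + v_i for all x, and define Φ(x) = x + h Σ_{i=1}^s α_i f(Y_i(x)) + v. Then Φ is a symplectic map: for every x, (DΦ(x))^⊤ J (DΦ(x)) = J. (This is the pathwise content of the theorem that an s-stage SRK method applied to a Hamiltonian system with additive noise is symplectic provided its deterministic coefficients satisfy α_i a_{ij} + α_j a_{ji} = α_i α_j, since for additive noise the stochastic increments enter only as constant shifts.) -/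
open Matrix

/-- The algebraic heart: the quadratic identity for Runge–Kutta Jacobians. -/
lemma srk_alg {m : Type*} [Fintype m] [DecidableEq m] {s : ℕ}
    (J : Matrix m m ℝ) (h : ℝ) (a : Fin s → Fin s → ℝ) (α : Fin s → ℝ)
    (hs : ∀ i j, α i * a i j + α j * a j i = α i * α j)
    (D K : Fin s → Matrix m m ℝ)
    (hD : ∀ i, D i = 1 + h • ∑ j, a i j • K j)
    (hK : ∀ i, (K i)ᵀ * J * D i + (D i)ᵀ * J * K i = 0) :
    (1 + h • ∑ i, α i • K i)ᵀ * J * (1 + h • ∑ i, α i • K i) = J := by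
  have e1 : ∀ i, (K i)ᵀ * J + J * K i =
      -(h • ∑ j, a i j • ((K i)ᵀ * J * K j + (K j)ᵀ * J * K i)) := by
    intro i
    have := hK i
    rw [hD i] at this
    rw [eq_neg_iff_add_eq_zero, ← this]
    simp only [transpose_add, transpose_one, transpose_smul, transpose_sum, mul_add, add_mul,
      mul_one, one_mul, Matrix.mul_smul, Matrix.smul_mul, Finset.mul_sum, Finset.sum_mul,
      smul_add, Finset.sum_add_distrib]
    abel
  have e2 : ∑ i, α i • ((K i)ᵀ * J + J * K i) =
      -(h • ∑ i, ∑ j, (α i * α j) • ((K i)ᵀ * J * K j)) := by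
    have e3 : ∑ i, ∑ j, (α i * α j) • ((K i)ᵀ * J * K j) =
        ∑ i, ∑ j, (α i * a i j) • ((K i)ᵀ * J * K j + (K j)ᵀ * J * K i) := by
      simp only [← hs, add_smul, smul_add, Finset.sum_add_distrib]
      congr 1
      rw [Finset.sum_comm]
    rw [e3]
    simp only [e1, smul_neg, Finset.sum_neg_distrib, Finset.smul_sum, smul_smul]
    congr 1
    refine Finset.sum_congr rfl fun i _ => Finset.sum_congr rfl fun j _ => ?_
    congr 1
    ring
  have e4 : (1 + h • ∑ i, α i • K i)ᵀ * J * (1 + h • ∑ i, α i • K i) =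
      J + h • (∑ i, α i • ((K i)ᵀ * J + J * K i)
        + h • ∑ i, ∑ j, (α i * α j) • ((K i)ᵀ * J * K j)) := by
    simp only [transpose_add, transpose_one, transpose_smul, transpose_sum, mul_add, add_mul,
      mul_one, one_mul, Matrix.mul_smul, Matrix.smul_mul, Finset.mul_sum, Finset.sum_mul,
      smul_add, Finset.sum_add_distrib, Finset.smul_sum, smul_smul]
    rw [Finset.sum_comm (f := fun i j => (h * (h * (α i * α j))) • ((K i)ᵀ * J * K j))]
    have e7 : ∀ i j, h * α i * (h * α j) = h * (h * (α j * α i)) := by intros; ring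
    simp only [e7]
    abel
  rw [e4, e2]
  simp

/-- Derivative of the Hamiltonian vector field. -/
lemma srk_field_deriv {m : Type*} [Fintype m] [DecidableEq m]
    (H : (m → ℝ) → ℝ) (hH : ContDiff ℝ 2 H) (A : Matrix m m ℝ)
    (f : (m → ℝ) → (m → ℝ))
    (hf : ∀ x, f x = A.mulVec (fun i => fderiv ℝ H x (Pi.single i 1))) (y : m → ℝ) :
    ∃ S : Matrix m m ℝ, Sᵀ = S ∧
      HasFDerivAt f (LinearMap.toContinuousLinearMap (Matrix.toLin' (A * S))) y := by
  set B := fderiv ℝ (fderiv ℝ H) y with hB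
  have hB' : HasFDerivAt (fderiv ℝ H) B y :=
    ((hH.fderiv_right (m := 1) (by norm_num)).differentiable (by norm_num) y).hasFDerivAt
  have hsym : ∀ u w, B u w = B w u := by
    have := (hH.contDiffAt (x := y)).isSymmSndFDerivAt (by simp)
    exact fun u w => this u w
  refine ⟨Matrix.of fun i j => B (Pi.single j 1) (Pi.single i 1), ?_, ?_⟩
  · ext i j
    simp [hsym (Pi.single i 1)]
  · have h1 : HasFDerivAt (fun x => fun i : m => fderiv ℝ H x (Pi.single i 1))
        (LinearMap.toContinuousLinearMap (Matrix.toLin'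
          (Matrix.of fun i j => B (Pi.single j 1) (Pi.single i 1)))) y := by
      rw [hasFDerivAt_pi']
      intro i
      have := hB'.clm_apply (hasFDerivAt_const (Pi.single i (1:ℝ) : m → ℝ) y)
      convert this using 1
      ext u
      have hu : u = ∑ j, u j • (Pi.single j (1:ℝ) : m → ℝ) := by
        simpa using (pi_eq_sum_univ' u)
      simp only [ContinuousLinearMap.comp_apply, ContinuousLinearMap.proj_apply,
        LinearMap.coe_toContinuousLinearMap', Matrix.toLin'_apply, mulVec, dotProduct, of_apply]
      conv_rhs => rw [hu]
      simp [mul_comm]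
    have h2 := (LinearMap.toContinuousLinearMap (Matrix.toLin' A)).hasFDerivAt.comp y h1
    have h3 : f = (LinearMap.toContinuousLinearMap (Matrix.toLin' A)) ∘
        (fun x => fun i : m => fderiv ℝ H x (Pi.single i 1)) := by
      funext x
      simp [hf]
    rw [h3]
    refine h2.congr_fderiv ?_
    ext u
    simp [Matrix.toLin'_mul]

/-- An s-stage (stochastic) Runge–Kutta map for a Hamiltonian system with additive
noise (the stochastic increments entering only as the constant shifts `v i`, `v0`)
is symplectic provided `αc i * a i j + αc j * a j i = αc i * αc j`. -/
theorem srk_additive_noise_symplectic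
    (n s : ℕ) (hn : 1 ≤ n) (hs : 1 ≤ s)
    (H : ((Fin n ⊕ Fin n) → ℝ) → ℝ) (hH : ContDiff ℝ 2 H)
    (J : Matrix (Fin n ⊕ Fin n) (Fin n ⊕ Fin n) ℝ)
    (hJ : J = Matrix.fromBlocks (0 : Matrix (Fin n) (Fin n) ℝ) (1 : Matrix (Fin n) (Fin n) ℝ)
        (-1 : Matrix (Fin n) (Fin n) ℝ) (0 : Matrix (Fin n) (Fin n) ℝ))
    (f : ((Fin n ⊕ Fin n) → ℝ) → ((Fin n ⊕ Fin n) → ℝ))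
    (hf : ∀ x, f x = J⁻¹.mulVec (fun i => fderiv ℝ H x (Pi.single i 1)))
    (h : ℝ) (hh : 0 < h)
    (a : Fin s → Fin s → ℝ) (αc : Fin s → ℝ)
    (hsymp : ∀ i j, αc i * a i j + αc j * a j i = αc i * αc j)
    (v : Fin s → (Fin n ⊕ Fin n) → ℝ) (v0 : (Fin n ⊕ Fin n) → ℝ)
    (Y : Fin s → ((Fin n ⊕ Fin n) → ℝ) → ((Fin n ⊕ Fin n) → ℝ))
    (hYdiff : ∀ i, Differentiable ℝ (Y i))
    (hY : ∀ i x, Y i x = x + h • (∑ j, a i j • f (Y j x)) + v i)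
    (Φ : ((Fin n ⊕ Fin n) → ℝ) → ((Fin n ⊕ Fin n) → ℝ))
    (hΦ : ∀ x, Φ x = x + h • (∑ i, αc i • f (Y i x)) + v0) :
    ∀ x : (Fin n ⊕ Fin n) → ℝ,
      (Matrix.of fun i j => fderiv ℝ Φ x (Pi.single j 1) i)ᵀ * J *
        (Matrix.of fun i j => fderiv ℝ Φ x (Pi.single j 1) i) = J := by
  intro x
  have hJJ : J * (-J) = 1 := by
    rw [hJ, fromBlocks_neg, fromBlocks_multiply]
    simp [fromBlocks_one]
  have hJi : J⁻¹ = -J := Matrix.inv_eq_right_inv hJJ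
  have hJt : Jᵀ = -J := by
    rw [hJ, fromBlocks_neg, fromBlocks_transpose]
    simp
  choose S hS hSd using fun i => srk_field_deriv H hH J⁻¹ f hf (Y i x)
  let D : Fin s → Matrix (Fin n ⊕ Fin n) (Fin n ⊕ Fin n) ℝ := fun i =>
    LinearMap.toMatrix' (fderiv ℝ (Y i) x : ((Fin n ⊕ Fin n) → ℝ) →ₗ[ℝ] ((Fin n ⊕ Fin n) → ℝ))
  have hDY : ∀ i, HasFDerivAt (Y i) (LinearMap.toContinuousLinearMap (Matrix.toLin' (D i))) x := by
    intro i
    refine (hYdiff i x).hasFDerivAt.congr_fderiv ?_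
    ext u
    simp [D]
  let K := fun i => J⁻¹ * S i * D i
  have hKd : ∀ i, HasFDerivAt (fun x => f (Y i x))
      (LinearMap.toContinuousLinearMap (Matrix.toLin' (K i))) x := by
    intro i
    refine ((hSd i).comp x (hDY i)).congr_fderiv ?_
    ext u
    simp [K, Matrix.toLin'_mul]
  have hcomb : ∀ (c : Fin s → ℝ) (w : (Fin n ⊕ Fin n) → ℝ),
      HasFDerivAt (fun x => x + h • (∑ j, c j • f (Y j x)) + w)
        (LinearMap.toContinuousLinearMap (Matrix.toLin' (1 + h • ∑ j, c j • K j))) x := by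
    intro c w
    have := (((hasFDerivAt_id (𝕜 := ℝ) x).add ((HasFDerivAt.fun_sum (u := Finset.univ)
      (fun j _ => (hKd j).const_smul (c j))).const_smul h)).add_const w)
    refine this.congr_fderiv ?_
    ext u
    simp
  have hD : ∀ i, D i = 1 + h • ∑ j, a i j • K j := by
    intro i
    have h1 := hcomb (a i) (v i)
    rw [← funext (hY i)] at h1
    have h2 := (hDY i).unique h1
    exact Matrix.toLin'.injective (LinearMap.toContinuousLinearMap.injective h2)
  have hM : (Matrix.of fun i j => fderiv ℝ Φ x (Pi.single j 1) i) =
      1 + h • ∑ j, αc j • K j := by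
    have h1 := hcomb αc v0
    rw [← funext hΦ] at h1
    rw [h1.fderiv]
    ext i j
    simp only [of_apply, LinearMap.coe_toContinuousLinearMap', Matrix.toLin'_apply,
      Matrix.mulVec_single_one, Matrix.col_apply]
  rw [hM]
  refine srk_alg J h a αc hsymp D K hD ?_
  intro i
  have k1 : J * K i = S i * D i := by
    simp only [K, hJi, ← Matrix.mul_assoc, hJJ, Matrix.one_mul]
  have k2 : (K i)ᵀ * J = -((D i)ᵀ * S i) := by
    have := congrArg transpose k1
    rw [transpose_mul J (K i), transpose_mul (S i) (D i), hJt, hS, Matrix.mul_neg] at this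
    rw [← this, neg_neg]
  rw [k2, Matrix.mul_assoc _ J, k1]
  simp [Matrix.mul_assoc]
end

section
/- For every α₁ ∈ (0,1), the 2-stage explicit SRK-α₁ coefficients defined by A = [[0, 0], [1/(2−2α₁), 0]], c = (0, 1/(2−2α₁)), α = (α₁, 1−α₁), Be = (−√(2(1−α₁)/(3α₁)), √(2α₁/(3(1−α₁)))), De = (1 + √(3(1−α₁)/(2α₁)), 1 + √(6α₁(1−α₁))/(2(α₁−1))), β = (0, 1), γ = (1, −1), ĉ = (0, 1) satisfy all ten order conditions: (1) c = Ae; (2) α^⊤e = 1; (3) β^⊤e = 1; (4) γ^⊤e = 0; (5) α^⊤Ae = 1/2; (6) α^⊤(Be) = 0; (7) α^⊤(De) = 1; (8) β^⊤ĉ = 1; (9) γ^⊤ĉ = −1; (10) α^⊤((Be)² + (De)²/3 + (Be)·(De)) = 1/2, where squares and products of vectors are componentwise. -/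
open Real

/-- The 2-stage explicit SRK-α₁ coefficients (Table 2) satisfy the ten order
conditions for mean-square order 1.5 for SDEs with additive noise. -/
theorem srk_alpha1_order_conditions
    (α₁ : ℝ) (hα₁ : α₁ ∈ Set.Ioo (0 : ℝ) 1)
    (A : Fin 2 → Fin 2 → ℝ) (c α Be De β γ ch : Fin 2 → ℝ)
    (hA : A = ![![0, 0], ![1 / (2 - 2 * α₁), 0]])
    (hc : c = ![0, 1 / (2 - 2 * α₁)])
    (hα : α = ![α₁, 1 - α₁])
    (hBe : Be = ![-Real.sqrt (2 * (1 - α₁) / (3 * α₁)), Real.sqrt (2 * α₁ / (3 * (1 - α₁)))])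
    (hDe : De = ![1 + Real.sqrt (3 * (1 - α₁) / (2 * α₁)),
        1 + Real.sqrt (6 * α₁ * (1 - α₁)) / (2 * (α₁ - 1))])
    (hβ : β = ![0, 1]) (hγ : γ = ![1, -1]) (hch : ch = ![0, 1]) :
    (∀ i, c i = ∑ j, A i j) ∧
    (∑ i, α i) = 1 ∧
    (∑ i, β i) = 1 ∧
    (∑ i, γ i) = 0 ∧
    (∑ i, α i * ∑ j, A i j) = 1 / 2 ∧
    (∑ i, α i * Be i) = 0 ∧
    (∑ i, α i * De i) = 1 ∧
    (∑ i, β i * ch i) = 1 ∧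
    (∑ i, γ i * ch i) = -1 ∧
    (∑ i, α i * ((Be i) ^ 2 + (De i) ^ 2 / 3 + Be i * De i)) = 1 / 2 := by
  obtain ⟨h0, h1⟩ := hα₁
  have hb : 0 < 1 - α₁ := by linarith
  have hab : 0 ≤ 6 * α₁ * (1 - α₁) := by positivity
  obtain ⟨b, hbd⟩ : ∃ b, b = 1 - α₁ := ⟨_, rfl⟩
  have e1 : (2 - 2 * α₁) = 2 * b := by rw [hbd]; ring
  have e2 : (α₁ - 1) = -b := by rw [hbd]; ring
  rw [e1] at hA hc
  rw [e2] at hDe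
  rw [← hbd] at hb hab hα hBe hDe
  obtain ⟨s, hs⟩ : ∃ s, s = Real.sqrt (6 * α₁ * b) := ⟨_, rfl⟩
  have hs0 : 0 ≤ s := hs ▸ Real.sqrt_nonneg _
  have hs2 : s ^ 2 = 6 * α₁ * b := by rw [hs]; exact Real.sq_sqrt hab
  have r1 : Real.sqrt (2 * b / (3 * α₁)) = s / (3 * α₁) := by
    rw [Real.sqrt_eq_iff_mul_self_eq (by positivity) (by positivity), ← sq, div_pow, hs2]
    field_simp
    try ring
  have r2 : Real.sqrt (2 * α₁ / (3 * b)) = s / (3 * b) := by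
    rw [Real.sqrt_eq_iff_mul_self_eq (by positivity) (by positivity), ← sq, div_pow, hs2]
    field_simp
    try ring
  have r3 : Real.sqrt (3 * b / (2 * α₁)) = s / (2 * α₁) := by
    rw [Real.sqrt_eq_iff_mul_self_eq (by positivity) (by positivity), ← sq, div_pow, hs2]
    field_simp
    try ring
  rw [r1, r2] at hBe
  rw [r3, ← hs] at hDe
  have hsum : α₁ + b = 1 := by rw [hbd]; ring
  have hb' : b ≠ 0 := hb.ne'
  have ha' : α₁ ≠ 0 := h0.ne'
  subst hA hc hα hBe hDe hβ hγ hch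
  refine ⟨?_, ?_, ?_, ?_, ?_, ?_, ?_, ?_, ?_, ?_⟩
  · intro i
    fin_cases i <;> simp [Fin.sum_univ_two]
  all_goals simp only [Fin.sum_univ_two, Matrix.cons_val_zero, Matrix.cons_val_one]
  · exact hsum
  · norm_num
  · norm_num
  · field_simp
    try ring
  · field_simp
    try ring
  · have : α₁ * (1 + s / (2 * α₁)) + b * (1 + s / (2 * -b)) = α₁ + b := by
      field_simp
      try ring
    rw [this, hsum]
  · norm_num
  · norm_num
  · have : α₁ * ((-(s / (3 * α₁))) ^ 2 + (1 + s / (2 * α₁)) ^ 2 / 3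
          + -(s / (3 * α₁)) * (1 + s / (2 * α₁)))
        + b * ((s / (3 * b)) ^ 2 + (1 + s / (2 * -b)) ^ 2 / 3
          + s / (3 * b) * (1 + s / (2 * -b)))
        = (α₁ + b) / 3 + s ^ 2 * (α₁ + b) / (36 * (α₁ * b)) := by
      field_simp
      try ring
    rw [this, hsum, hs2]
    field_simp
    try norm_num
end

section
/- For every α₁ ∈ (0,1), the 2-stage diagonal implicit SSRK-α₁ coefficients defined by A = [[α₁/2, 0], [α₁, (1−α₁)/2]], c = (α₁/2, (α₁+1)/2), α = (α₁, 1−α₁), Be = (−√(2(1−α₁)/(3α₁)), √(2α₁/(3(1−α₁)))), De = (1 + √(3(1−α₁)/(2α₁)), 1 + √(6α₁(1−α₁))/(2(α₁−1))), β = (0, 1), γ = (1, −1), ĉ = (0, 1) satisfy all ten order conditions: (1) c = Ae; (2) α^⊤e = 1; (3) β^⊤e = 1; (4) γ^⊤e = 0; (5) α^⊤Ae = 1/2; (6) α^⊤(Be) = 0; (7) α^⊤(De) = 1; (8) β^⊤ĉ = 1; (9) γ^⊤ĉ = −1; (10) α^⊤((Be)² + (De)²/3 + (Be)·(De)) = 1/2.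 -/
open Real

/-- The 2-stage diagonal implicit SSRK-α₁ coefficients (Table 5) satisfy the ten
order conditions for mean-square order 1.5 for SDEs with additive noise. -/
theorem ssrk_alpha1_order_conditions
    (α₁ : ℝ) (hα₁ : α₁ ∈ Set.Ioo (0 : ℝ) 1)
    (A : Fin 2 → Fin 2 → ℝ) (c α Be De β γ ch : Fin 2 → ℝ)
    (hA : A = ![![α₁ / 2, 0], ![α₁, (1 - α₁) / 2]])
    (hc : c = ![α₁ / 2, (α₁ + 1) / 2])
    (hα : α = ![α₁, 1 - α₁])
    (hBe : Be = ![-Real.sqrt (2 * (1 - α₁) / (3 * α₁)), Real.sqrt (2 * α₁ / (3 * (1 - α₁)))])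
    (hDe : De = ![1 + Real.sqrt (3 * (1 - α₁) / (2 * α₁)),
        1 + Real.sqrt (6 * α₁ * (1 - α₁)) / (2 * (α₁ - 1))])
    (hβ : β = ![0, 1]) (hγ : γ = ![1, -1]) (hch : ch = ![0, 1]) :
    (∀ i, c i = ∑ j, A i j) ∧
    (∑ i, α i) = 1 ∧
    (∑ i, β i) = 1 ∧
    (∑ i, γ i) = 0 ∧
    (∑ i, α i * ∑ j, A i j) = 1 / 2 ∧
    (∑ i, α i * Be i) = 0 ∧
    (∑ i, α i * De i) = 1 ∧
    (∑ i, β i * ch i) = 1 ∧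
    (∑ i, γ i * ch i) = -1 ∧
    (∑ i, α i * ((Be i) ^ 2 + (De i) ^ 2 / 3 + Be i * De i)) = 1 / 2 := by
  obtain ⟨h0, h1⟩ := hα₁
  have hb : 0 < 1 - α₁ := by linarith
  have hane : α₁ ≠ 0 := h0.ne'
  have hbne : 1 - α₁ ≠ 0 := hb.ne'
  obtain ⟨s, hs⟩ : ∃ s, s = Real.sqrt (6 * α₁ * (1 - α₁)) := ⟨_, rfl⟩
  have hs0 : 0 ≤ s := hs ▸ Real.sqrt_nonneg _
  have hs2 : s ^ 2 = 6 * α₁ * (1 - α₁) := by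
    rw [hs]; exact Real.sq_sqrt (by positivity)
  have e1 : Real.sqrt (2 * (1 - α₁) / (3 * α₁)) = s / (3 * α₁) := by
    rw [Real.sqrt_eq_iff_mul_self_eq (by positivity) (by positivity), ← pow_two, div_pow, hs2]
    field_simp
    ring
  have e2 : Real.sqrt (2 * α₁ / (3 * (1 - α₁))) = s / (3 * (1 - α₁)) := by
    rw [Real.sqrt_eq_iff_mul_self_eq (by positivity) (by positivity), ← pow_two, div_pow, hs2]
    field_simp
    ring
  have e3 : Real.sqrt (3 * (1 - α₁) / (2 * α₁)) = s / (2 * α₁) := by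
    rw [Real.sqrt_eq_iff_mul_self_eq (by positivity) (by positivity), ← pow_two, div_pow, hs2]
    field_simp
    ring
  have e4 : s / (2 * (α₁ - 1)) = -(s / (2 * (1 - α₁))) := by
    rw [← div_neg]; congr 1; ring
  rw [e1, e2] at hBe
  rw [e3, ← hs, e4] at hDe
  subst hA hc hα hBe hDe hβ hγ hch
  simp only [Fin.sum_univ_two, Fin.forall_fin_two, Matrix.cons_val_zero, Matrix.cons_val_one]
  refine ⟨⟨by ring, by ring⟩, by ring, by ring, by ring, by ring, ?_, ?_, by ring, by ring, ?_⟩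
  · field_simp
    ring
  · field_simp
    ring
  · have k1 : α₁ * (s / α₁) ^ 2 = 6 * (1 - α₁) := by
      rw [div_pow, hs2]; field_simp
    have k2 : (1 - α₁) * (s / (1 - α₁)) ^ 2 = 6 * α₁ := by
      rw [div_pow, hs2]; field_simp
    have r1 : s / (3 * α₁) = (s / α₁) / 3 := by field_simp
    have r2 : s / (3 * (1 - α₁)) = (s / (1 - α₁)) / 3 := by field_simp
    have r3 : s / (2 * α₁) = (s / α₁) / 2 := by field_simp
    have r4 : s / (2 * (1 - α₁)) = (s / (1 - α₁)) / 2 := by field_simp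
    rw [r1, r2, r3, r4]
    generalize s / α₁ = x at *
    generalize s / (1 - α₁) = y at *
    linear_combination k1 / 36 + k2 / 36
end

section
/- Let α₁ ∈ (0,1) and let b₁ ∈ ℝ satisfy −(2/3)√((1−α₁)/α₁) < b₁ < (2/3)√((1−α₁)/α₁) (so that 2/α₁ − 3b₁² − 2 > 0). Then the 2-stage diagonal implicit SSRK-α₁-b₁ coefficients defined by A = [[α₁/2, 0], [α₁, (1−α₁)/2]], c = (α₁/2, (α₁+1)/2), α = (α₁, 1−α₁), Be = (b₁, α₁b₁/(α₁−1)), De = (1 − 3b₁/2 − (1/2)√(2/α₁ − 3b₁² − 2), 1 − (3b₁α₁ + α₁√(2/α₁ − 3b₁² − 2))/(2(α₁−1))), β = (0, 1), γ = (1, −1), ĉ = (0, 1) satisfy all ten order conditions: (1) c = Ae; (2) α^⊤e = 1; (3) β^⊤e = 1; (4) γ^⊤e = 0; (5) α^⊤Ae = 1/2; (6) α^⊤(Be) = 0; (7) α^⊤(De) = 1; (8) β^⊤ĉ = 1; (9) γ^⊤ĉ = −1; (10) α^⊤((Be)² + (De)²/3 + (Be)·(De)) = 1/2. -/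
open Real

/-- The 2-stage diagonal implicit SSRK-α₁-b₁ coefficients (Table 6) satisfy the ten
order conditions for mean-square order 1.5 for SDEs with additive noise. -/
theorem ssrk_alpha1_b1_order_conditions
    (α₁ b₁ : ℝ) (hα₁ : α₁ ∈ Set.Ioo (0 : ℝ) 1)
    (hb₁ : b₁ ∈ Set.Ioo (-(2 / 3) * Real.sqrt ((1 - α₁) / α₁)) ((2 / 3) * Real.sqrt ((1 - α₁) / α₁)))
    (A : Fin 2 → Fin 2 → ℝ) (c α Be De β γ ch : Fin 2 → ℝ)
    (hA : A = ![![α₁ / 2, 0], ![α₁, (1 - α₁) / 2]])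
    (hc : c = ![α₁ / 2, (α₁ + 1) / 2])
    (hα : α = ![α₁, 1 - α₁])
    (hBe : Be = ![b₁, α₁ * b₁ / (α₁ - 1)])
    (hDe : De = ![1 - 3 * b₁ / 2 - (1 / 2) * Real.sqrt (2 / α₁ - 3 * b₁ ^ 2 - 2),
        1 - (3 * b₁ * α₁ + α₁ * Real.sqrt (2 / α₁ - 3 * b₁ ^ 2 - 2)) / (2 * (α₁ - 1))])
    (hβ : β = ![0, 1]) (hγ : γ = ![1, -1]) (hch : ch = ![0, 1]) :
    (∀ i, c i = ∑ j, A i j) ∧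
    (∑ i, α i) = 1 ∧
    (∑ i, β i) = 1 ∧
    (∑ i, γ i) = 0 ∧
    (∑ i, α i * ∑ j, A i j) = 1 / 2 ∧
    (∑ i, α i * Be i) = 0 ∧
    (∑ i, α i * De i) = 1 ∧
    (∑ i, β i * ch i) = 1 ∧
    (∑ i, γ i * ch i) = -1 ∧
    (∑ i, α i * ((Be i) ^ 2 + (De i) ^ 2 / 3 + Be i * De i)) = 1 / 2 := by
  obtain ⟨h0, h1⟩ := hα₁
  obtain ⟨hl, hu⟩ := hb₁
  have hq : 0 ≤ (1 - α₁) / α₁ := div_nonneg (by linarith) h0.le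
  have hs := Real.sq_sqrt hq
  have hs0 := Real.sqrt_nonneg ((1 - α₁) / α₁)
  have hb : b₁ ^ 2 ≤ 4 / 9 * ((1 - α₁) / α₁) := by
    nlinarith
  have hq' : (1 - α₁) / α₁ = 1 / α₁ - 1 := by field_simp
  have hq2 : 2 / α₁ = 2 * (1 / α₁) := by ring
  have hpos : 0 ≤ 2 / α₁ - 3 * b₁ ^ 2 - 2 := by
    rw [hq2]; linarith
  have hS := Real.sq_sqrt hpos
  set S := Real.sqrt (2 / α₁ - 3 * b₁ ^ 2 - 2) with hSdef
  clear_value S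
  have hne : α₁ ≠ 0 := h0.ne'
  have hne1 : α₁ - 1 ≠ 0 := by linarith
  have hS' : α₁ * S ^ 2 = 2 - 3 * b₁ ^ 2 * α₁ - 2 * α₁ := by
    rw [hS]; field_simp
  subst hA hc hα hBe hDe hβ hγ hch
  refine ⟨?_, ?_, ?_, ?_, ?_, ?_, ?_, ?_, ?_, ?_⟩
  · intro i
    fin_cases i <;> simp [Fin.sum_univ_two]
    ring
  all_goals simp only [Fin.sum_univ_two, Matrix.cons_val_zero, Matrix.cons_val_one]
  · ring
  · ring
  · ring
  · ring
  · field_simp; ring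
  · field_simp; ring
  · ring
  · ring
  · obtain ⟨r, hr⟩ : ∃ r, r = α₁ / (α₁ - 1) := ⟨_, rfl⟩
    have hr1 : r * (α₁ - 1) = α₁ := by rw [hr]; field_simp
    have e1 : α₁ * b₁ / (α₁ - 1) = r * b₁ := by rw [hr]; ring
    have e2 : (3 * b₁ * α₁ + α₁ * S) / (2 * (α₁ - 1)) = r * (3 * b₁ + S) / 2 := by
      rw [hr]; field_simp
    rw [e1, e2]
    have h3 : r * (S ^ 2 + 3 * b₁ ^ 2) = -2 := by
      rw [hr, div_mul_eq_mul_div, div_eq_iff hne1]; linarith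
    have key : α₁ * (b₁ ^ 2 + (1 - 3 * b₁ / 2 - 1 / 2 * S) ^ 2 / 3 + b₁ * (1 - 3 * b₁ / 2 - 1 / 2 * S))
      + (1 - α₁) * ((r * b₁) ^ 2 + (1 - r * (3 * b₁ + S) / 2) ^ 2 / 3 + r * b₁ * (1 - r * (3 * b₁ + S) / 2))
      = 1 / 3 + (α₁ - r * α₁) * ((S ^ 2 + 3 * b₁ ^ 2) / 12) := by
      have : α₁ = r * (α₁ - 1) := hr1.symm
      linear_combination (-(r * (S ^ 2 + 3 * b₁ ^ 2) / 12) - (-S / 3)) * hr1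
    have h4 : α₁ - r * α₁ = -r := by linarith
    rw [key, h4]; linarith
end

section
/- For α₁ ∈ (0,1) and h > 0 define C_{α₁}(h) = −((√6 α₁ + 2√(1/α₁ − 1) − √6) h² ((α₁−1)α₁ h² + 4)) / (6 √(1/α₁ − 1) ((α₁−1)² h² + 4)(α₁² h² + 4)). Then for every fixed h ∈ (0,1), the function α₁ ↦ |C_{α₁}(h)| on (0,1) attains its minimum uniquely at α₁ = 1/2; that is, |C_{1/2}(h)| ≤ |C_{α₁}(h)| for all α₁ ∈ (0,1), with equality if and only if α₁ = 1/2. -/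
open Real

theorem aux_form (a h : ℝ) (ha0 : 0 < a) (ha1 : a < 1) (h0 : 0 < h) (h1 : h < 1) :
    ∃ r : ℝ, 0 < r ∧ r ^ 2 = a * (1 - a) ∧
    |-((Real.sqrt 6 * a + 2 * Real.sqrt (1 / a - 1) - Real.sqrt 6) * h ^ 2
          * ((a - 1) * a * h ^ 2 + 4))
        / (6 * Real.sqrt (1 / a - 1) * ((a - 1) ^ 2 * h ^ 2 + 4)
          * (a ^ 2 * h ^ 2 + 4))| =
      h ^ 2 / 6 * ((2 - Real.sqrt 6 * r) * (4 - r ^ 2 * h ^ 2) /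
        (r ^ 4 * h ^ 4 + 4 * h ^ 2 * (1 - 2 * r ^ 2) + 16)) := by
  have hpos : 0 < 1 / a - 1 := by
    rw [sub_pos, lt_div_iff₀ ha0]; linarith
  have hs : 0 < Real.sqrt (1 / a - 1) := Real.sqrt_pos.mpr hpos
  have hs2 : Real.sqrt (1 / a - 1) ^ 2 = 1 / a - 1 := Real.sq_sqrt hpos.le
  have hk : 0 < Real.sqrt 6 := by positivity
  have hk2 : Real.sqrt 6 ^ 2 = 6 := Real.sq_sqrt (by norm_num)
  generalize Real.sqrt (1 / a - 1) = s at *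
  generalize Real.sqrt 6 = k at *
  have has : a * s ^ 2 = 1 - a := by rw [hs2]; field_simp
  have hr2 : (a * s) ^ 2 = a * (1 - a) := by rw [← has]; ring
  refine ⟨a * s, by positivity, hr2, ?_⟩
  have hr : a * s ≤ 1 / 2 := by nlinarith [sq_nonneg (a - 1 / 2), mul_pos ha0 hs]
  have hk3 : k < 5 / 2 := by nlinarith
  have hkr : 0 < 2 - k * (a * s) := by nlinarith [mul_pos ha0 hs]
  have hD : (a * s) ^ 4 * h ^ 4 + 4 * h ^ 2 * (1 - 2 * (a * s) ^ 2) + 16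
      = ((a - 1) ^ 2 * h ^ 2 + 4) * (a ^ 2 * h ^ 2 + 4) := by
    have : (a * s) ^ 4 = (a * (1 - a)) ^ 2 := by rw [← hr2]; ring
    rw [this, hr2]; ring
  have hN : k * a + 2 * s - k = s * (2 - k * (a * s)) := by
    linear_combination k * has
  have hx : h ^ 2 < 1 := by nlinarith
  have h4 : 0 < 4 - (a * s) ^ 2 * h ^ 2 := by nlinarith [mul_pos ha0 hs, sq_nonneg h, sq_nonneg (a * s)]
  have hN2 : (a - 1) * a * h ^ 2 + 4 = 4 - (a * s) ^ 2 * h ^ 2 := by rw [hr2]; ring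
  rw [hD, hN, hN2, neg_div, abs_neg, abs_of_pos (by positivity)]
  field_simp

theorem aux_lt (r h : ℝ) (hr0 : 0 < r) (hr : r < 1 / 2) (h0 : 0 < h) (h1 : h < 1) :
    (2 - Real.sqrt 6 * (1 / 2)) * (4 - (1 / 2) ^ 2 * h ^ 2) /
        ((1 / 2) ^ 4 * h ^ 4 + 4 * h ^ 2 * (1 - 2 * (1 / 2) ^ 2) + 16) <
    (2 - Real.sqrt 6 * r) * (4 - r ^ 2 * h ^ 2) /
        (r ^ 4 * h ^ 4 + 4 * h ^ 2 * (1 - 2 * r ^ 2) + 16) := by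
  have hk : 0 < Real.sqrt 6 := by positivity
  have hk2 : Real.sqrt 6 ^ 2 = 6 := Real.sq_sqrt (by norm_num)
  generalize Real.sqrt 6 = k at *
  have hk3 : k < 5 / 2 := by nlinarith
  have hk4 : 2 < k := by nlinarith
  have hx0 : 0 < h ^ 2 := by positivity
  have hx1 : h ^ 2 < 1 := by nlinarith
  have e : h ^ 4 = (h ^ 2) ^ 2 := by ring
  rw [e]
  generalize h ^ 2 = x at *
  have hr2 : r ^ 2 < 1 / 4 := by nlinarith
  have hd1 : 0 < 1 - 2 * r ^ 2 := by linarith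
  have hD : 0 < r ^ 4 * x ^ 2 + 4 * x * (1 - 2 * r ^ 2) + 16 := by positivity
  have hr4 : r ^ 4 < 1 / 16 := by nlinarith [sq_nonneg r]
  have hDD : r ^ 4 * x ^ 2 + 4 * x * (1 - 2 * r ^ 2) + 16 ≤
      ((1 / 2) ^ 4 * x ^ 2 + 4 * x * (1 - 2 * (1 / 2) ^ 2) + 16) + 8 * (1 / 2 - r) := by
    have t1 : 0 ≤ (1 / 16 - r ^ 4) * x ^ 2 := mul_nonneg (by linarith) (sq_nonneg x)
    have t2 : 0 ≤ (1 - x) * (1 / 4 - r ^ 2) := mul_nonneg (by linarith) (by linarith)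
    nlinarith
  have hE : 16 ≤ (1 / 2) ^ 4 * x ^ 2 + 4 * x * (1 - 2 * (1 / 2) ^ 2) + 16 := by
    nlinarith [sq_nonneg x]
  generalize r ^ 4 * x ^ 2 + 4 * x * (1 - 2 * r ^ 2) + 16 = D at *
  generalize (1 / 2) ^ 4 * x ^ 2 + 4 * x * (1 - 2 * (1 / 2) ^ 2) + 16 = E at *
  have h4 : 4 - (1 / 2) ^ 2 * x ≤ 4 - r ^ 2 * x := by nlinarith
  have h4p : 0 < 4 - (1 / 2) ^ 2 * x := by linarith
  have hkk : 0 < 2 - k * r := by nlinarith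
  rw [div_lt_div_iff₀ (by linarith) hD]
  have key : (2 - k * (1 / 2)) * D < (2 - k * r) * E := by
    have a1 : (2 - k * (1 / 2)) * D ≤ (2 - k * (1 / 2)) * (E + 8 * (1 / 2 - r)) :=
      mul_le_mul_of_nonneg_left hDD (by linarith)
    have a2 : 0 ≤ k * (1 / 2 - r) * (E - 16) :=
      mul_nonneg (mul_nonneg hk.le (by linarith)) (by linarith)
    have a3 : 0 < (1 / 2 - r) * (16 * k - (2 - k * (1 / 2)) * 8) :=
      mul_pos (by linarith) (by linarith)
    nlinarith
  calc (2 - k * (1 / 2)) * (4 - (1 / 2) ^ 2 * x) * D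
      = ((2 - k * (1 / 2)) * D) * (4 - (1 / 2) ^ 2 * x) := by ring
    _ < ((2 - k * r) * E) * (4 - (1 / 2) ^ 2 * x) := mul_lt_mul_of_pos_right key h4p
    _ ≤ ((2 - k * r) * E) * (4 - r ^ 2 * x) :=
      mul_le_mul_of_nonneg_left h4 (mul_nonneg hkk.le (by linarith))
    _ = (2 - k * r) * (4 - r ^ 2 * x) * E := by ring

/-- For each fixed `h ∈ (0,1)`, the deviation coefficient `|C_{α₁}(h)|` of the
SSRK-α₁ family attains its minimum over `α₁ ∈ (0,1)` uniquely at `α₁ = 1/2`. -/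
theorem ssrk_alpha1_optimal_parameter
    (C : ℝ → ℝ → ℝ)
    (hC : ∀ α₁ h : ℝ, C α₁ h =
      -((Real.sqrt 6 * α₁ + 2 * Real.sqrt (1 / α₁ - 1) - Real.sqrt 6) * h ^ 2
          * ((α₁ - 1) * α₁ * h ^ 2 + 4))
        / (6 * Real.sqrt (1 / α₁ - 1) * ((α₁ - 1) ^ 2 * h ^ 2 + 4)
          * (α₁ ^ 2 * h ^ 2 + 4))) :
    ∀ h ∈ Set.Ioo (0 : ℝ) 1, ∀ α₁ ∈ Set.Ioo (0 : ℝ) 1,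
      |C (1 / 2) h| ≤ |C α₁ h| ∧ (|C (1 / 2) h| = |C α₁ h| ↔ α₁ = 1 / 2) := by
  rintro h ⟨h0, h1⟩ a ⟨ha0, ha1⟩
  by_cases ha : a = 1 / 2
  · subst ha; simp
  have hlt : |C (1 / 2) h| < |C a h| := by
    obtain ⟨r, hr0, hr2, hr⟩ := aux_form a h ha0 ha1 h0 h1
    obtain ⟨q, hq0, hq2, hq⟩ := aux_form (1 / 2) h (by norm_num) (by norm_num) h0 h1
    have hq' : q = 1 / 2 := by nlinarith
    have hr' : r < 1 / 2 := by
      have : 0 < (a - 1 / 2) ^ 2 := by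
        have := sub_ne_zero.mpr ha
        positivity
      nlinarith
    rw [hC, hC, hr, hq, hq']
    exact mul_lt_mul_of_pos_left (aux_lt r h hr0 hr' h0 h1) (by positivity)
  exact ⟨hlt.le, fun e => absurd e hlt.ne, fun e => absurd e ha⟩
end

section
/- For b₁ ∈ (−√(2/3), √(2/3)) and h > 0 define C_{b₁}(h) = (3√(2 − 3b₁²) − 3b₁ − 4)(16 − h²) h² / (3(16 + h²)). Then for b₁ in this range, 3√(2 − 3b₁²) − 3b₁ − 4 = 0 if and only if b₁ = (−2 + √6)/6 or b₁ = (−2 − √6)/6. Consequently, for b₁ = (−2 + √6)/6 and for b₁ = (−2 − √6)/6, C_{b₁}(h) = 0 for every h > 0. -/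
open Real

/-- For `b₁ ∈ (−√(2/3), √(2/3))`, the factor `3√(2−3b₁²) − 3b₁ − 4` vanishes iff
`b₁ = (−2±√6)/6`; consequently for these two values the deviation coefficient
`C_{b₁}(h)` of the SSRK-0.5-b₁ scheme vanishes for every `h > 0`. -/
theorem ssrk_b1_exact_linear_growth
    (C : ℝ → ℝ → ℝ)
    (hC : ∀ b₁ h : ℝ, C b₁ h =
      (3 * Real.sqrt (2 - 3 * b₁ ^ 2) - 3 * b₁ - 4) * (16 - h ^ 2) * h ^ 2
        / (3 * (16 + h ^ 2))) :
    (∀ b₁ ∈ Set.Ioo (-Real.sqrt (2 / 3)) (Real.sqrt (2 / 3)),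
      (3 * Real.sqrt (2 - 3 * b₁ ^ 2) - 3 * b₁ - 4 = 0 ↔
        b₁ = (-2 + Real.sqrt 6) / 6 ∨ b₁ = (-2 - Real.sqrt 6) / 6)) ∧
    (∀ b₁ : ℝ, (b₁ = (-2 + Real.sqrt 6) / 6 ∨ b₁ = (-2 - Real.sqrt 6) / 6) →
      ∀ h : ℝ, 0 < h → C b₁ h = 0) := by
  have h6 : Real.sqrt 6 ^ 2 = 6 := Real.sq_sqrt (by norm_num)
  have h6n : 0 ≤ Real.sqrt 6 := Real.sqrt_nonneg 6
  have h63 : Real.sqrt 6 ≤ 3 := by nlinarith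
  have key : ∀ b₁ : ℝ, (b₁ = (-2 + Real.sqrt 6) / 6 ∨ b₁ = (-2 - Real.sqrt 6) / 6) →
      3 * Real.sqrt (2 - 3 * b₁ ^ 2) - 3 * b₁ - 4 = 0 := by
    intro b hb
    have h1 : 2 - 3 * b ^ 2 = (b + 4 / 3) ^ 2 := by
      rcases hb with rfl | rfl <;> nlinarith
    have h2 : 0 ≤ b + 4 / 3 := by
      rcases hb with rfl | rfl <;> linarith
    rw [h1, Real.sqrt_sq h2]
    ring
  refine ⟨fun b hb => ⟨fun h => ?_, key b⟩, fun b hb h _ => ?_⟩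
  · have hb2 : b ^ 2 < 2 / 3 := by
      have h23 : Real.sqrt (2 / 3) ^ 2 = 2 / 3 := Real.sq_sqrt (by norm_num)
      rw [← h23]
      exact sq_lt_sq' hb.1 hb.2
    have hs : Real.sqrt (2 - 3 * b ^ 2) ^ 2 = 2 - 3 * b ^ 2 := Real.sq_sqrt (by linarith)
    have he : Real.sqrt (2 - 3 * b ^ 2) = b + 4 / 3 := by linarith
    rw [he] at hs
    have hp : (b - (-2 + Real.sqrt 6) / 6) * (b - (-2 - Real.sqrt 6) / 6) = 0 := by
      nlinarith
    rcases mul_eq_zero.mp hp with h' | h'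
    · left; linarith
    · right; linarith
  · rw [hC, key b hb]
    simp
end

section
/- Let n ≥ 1, let U : ℝⁿ → ℝ be twice continuously differentiable, let M be an invertible n×n real matrix, and define f : ℝⁿ × ℝⁿ → ℝⁿ × ℝⁿ by f(p, q) = (−∇U(q), M⁻¹ p). Then for every x = (p, q) ∈ ℝⁿ × ℝⁿ and all vectors v = (σ, 0), w = (σ′, 0) ∈ ℝⁿ × ℝⁿ whose second (q-) component is zero, the second Fréchet derivative of f satisfies D²f(x)(v, w) = 0. -/
open Matrix

/-- For the drift `f(p,q) = (−∇U(q), M⁻¹p)` of a second-order Hamiltonian system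
with additive noise, the second Fréchet derivative vanishes on pairs of directions
whose `q`-component is zero: `D²f(x)((σ,0), (σ′,0)) = 0`. -/
theorem second_order_hamiltonian_drift_second_derivative_vanishes
    (n : ℕ) (hn : 1 ≤ n)
    (U : (Fin n → ℝ) → ℝ) (hU : ContDiff ℝ 2 U)
    (M : Matrix (Fin n) (Fin n) ℝ) (hM : IsUnit M.det)
    (f : (Fin n → ℝ) × (Fin n → ℝ) → (Fin n → ℝ) × (Fin n → ℝ))
    (hf : ∀ p q : Fin n → ℝ,
      f (p, q) = (-(fun i => fderiv ℝ U q (Pi.single i 1)), M⁻¹.mulVec p)) :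
    ∀ (x : (Fin n → ℝ) × (Fin n → ℝ)) (σ σ' : Fin n → ℝ),
      fderiv ℝ (fderiv ℝ f) x ((σ, 0) : (Fin n → ℝ) × (Fin n → ℝ))
        ((σ', 0) : (Fin n → ℝ) × (Fin n → ℝ)) = 0 := by
  intro x σ σ'
  let G : (Fin n → ℝ) → (Fin n → ℝ) := fun q => -(fun i => fderiv ℝ U q (Pi.single i 1))
  have hdU : Differentiable ℝ (fderiv ℝ U) :=
    (hU.fderiv_right (m := 1) (by norm_num)).differentiable (by norm_num)
  have hG : Differentiable ℝ G := by
    refine Differentiable.neg ?_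
    rw [differentiable_pi]
    intro i
    exact hdU.clm_apply (differentiable_const _)
  let B : (Fin n → ℝ) →L[ℝ] (Fin n → ℝ) := LinearMap.toContinuousLinearMap (Matrix.mulVecLin M⁻¹)
  have hfe : f = fun y => (G y.2, B y.1) := by
    funext y
    exact hf y.1 y.2
  have hf' : ∀ y, fderiv ℝ f y (σ', 0) = (0, B σ') := by
    intro y
    have h1 : HasFDerivAt (fun y : (Fin n → ℝ) × (Fin n → ℝ) => G y.2)
        ((fderiv ℝ G y.2).comp (ContinuousLinearMap.snd ℝ _ _)) y :=
      HasFDerivAt.comp (g := G) y (hG y.2).hasFDerivAt hasFDerivAt_snd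
    have h2 : HasFDerivAt (fun y : (Fin n → ℝ) × (Fin n → ℝ) => B y.1)
        (B.comp (ContinuousLinearMap.fst ℝ _ _)) y :=
      HasFDerivAt.comp (g := B) y B.hasFDerivAt hasFDerivAt_fst
    have h3 := h1.prodMk h2
    rw [hfe, h3.fderiv]
    simp
  by_cases hd : DifferentiableAt ℝ (fderiv ℝ f) x
  · have h4 := hd.hasFDerivAt.clm_apply
      (hasFDerivAt_const ((σ', 0) : (Fin n → ℝ) × (Fin n → ℝ)) x)
    have h5 : (fun y => fderiv ℝ f y (σ', 0)) = fun _ => ((0, B σ') : (Fin n → ℝ) × (Fin n → ℝ)) :=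
      funext hf'
    rw [h5] at h4
    have h6 := congrArg (fun L => L ((σ, 0) : (Fin n → ℝ) × (Fin n → ℝ)))
      (h4.unique (hasFDerivAt_const _ x))
    simpa using h6
  · rw [fderiv_zero_of_not_differentiableAt hd]
    simp
end
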